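/- For all integers m ≥ 1 and n ≥ m, there exists a real number δ > 0 such that the set {p ≥ 1 : A^(m)(p) = n} has asymptotic density δ, i.e., (1/N)·#{p : 1 ≤ p ≤ N and A^(m)(p) = n} → δ as N → ∞. -/

import Mathlib

open List Filter

open scoped Classical

noncomputable section

/-- The curling number of a finite string: the largest `k` such that
`S = X ++ Y^k` with `Y` nonempty; by convention `curl [] = 1`. -/
def curl (S : List ℕ) : ℕ :=
  max 1 (sSup {k | ∃ X Y : List ℕ, Y ≠ [] ∧ S = X ++ (List.replicate k Y).flatten})

/-- The prefix of length `n` of the level-`m` Gijswijt sequence `A^(m)`. -/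
def gPrefix (m : ℕ) : ℕ → List ℕ
  | 0 => []
  | n + 1 => gPrefix m n ++ [max m (curl (gPrefix m n))]

/-- `gij m p` is the `p`-th term (1-indexed) of the level-`m` Gijswijt sequence `A^(m)`. -/
def gij (m p : ℕ) : ℕ := max m (curl (gPrefix m (p - 1)))

/-- Standing hypothesis: for every `m ≥ 1`, the sets
`{k ≥ 0 : C(A^(m)[1,k]) ≤ m}` and `{k ≥ 0 : C(A^(m+1)[1,k]) ≤ m}` are infinite. -/
def StandingHyp : Prop :=
  ∀ m : ℕ, 1 ≤ m →
    {k : ℕ | curl (gPrefix m k) ≤ m}.Infinite ∧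
    {k : ℕ | curl (gPrefix (m + 1) k) ≤ m}.Infinite

/-- Length of `π^(m)(1,x)`: the `x`-th smallest (0-indexed) element of
`{k : C(A^(m)[1,k]) ≤ m}`. -/
def piLen (m x : ℕ) : ℕ := Nat.nth (fun k => curl (gPrefix m k) ≤ m) x

/-- `π^(m)(1,x)`: the prefix of `A^(m)` with exactly `x` occurrences of `m`
and curling number at most `m`. -/
def piStr (m x : ℕ) : List ℕ := gPrefix m (piLen m x)

/-- `β^(m)(t)`, the length of `B_t^(m)`. -/
def beta (m t : ℕ) : ℕ := piLen m ((m + 1) ^ (t - 1))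

/-- `B_t^(m) := π^(m)(1,(m+1)^(t-1))`. -/
def Bstr (m t : ℕ) : List ℕ := piStr m ((m + 1) ^ (t - 1))

/-- `τ^(m)(t)`, the length of `T_t^(m)`. -/
def tau (m t : ℕ) : ℕ := Nat.nth (fun k => curl (gPrefix (m + 1) k) ≤ m) (t - 1)

/-- `T_t^(m)`: the `t`-th shortest prefix of `A^(m+1)` with curling number at most `m`. -/
def Tstr (m t : ℕ) : List ℕ := gPrefix (m + 1) (tau m t)

/-- `φ^(m)(n)`: the least `p ≥ 1` with `A^(m)(p) = n`. -/
def phi (m n : ℕ) : ℕ := sInf {p : ℕ | 1 ≤ p ∧ gij m p = n}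

/-- `t^(m)(n) = 1 + log_{m+1} #\{i ≤ φ^(m)(n) : A^(m)(i) = m\}`. -/
def tfun (m n : ℕ) : ℕ := 1 + Nat.log (m + 1) ((gPrefix m (phi m n)).count m)

/-- `χ^(b)(a)`: read the base-`b` digits of `a` as base-`(b+1)` digits. -/
def chi (b a : ℕ) : ℕ := Nat.ofDigits (b + 1) (Nat.digits b a)

/-- `ι_m(t)`: read the base-`(m+2)` digits of the number of occurrences of `m+1`
in `T_t^(m)` as base-`(m+1)` digits. -/
def iota (m t : ℕ) : ℕ :=
  Nat.ofDigits (m + 1) (Nat.digits (m + 2) ((Tstr m t).count (m + 1)))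

/-- `ι_m⁻¹(p)`: the largest `x ≥ 1` with `ι_m(x) ≤ p`. -/
def iotaInv (m p : ℕ) : ℕ := sSup {x : ℕ | 1 ≤ x ∧ iota m x ≤ p}

/-- `ord_b(n)`: the `b`-adic valuation of `n`. -/
def ordb (b n : ℕ) : ℕ := sSup {z : ℕ | b ^ z ∣ n}

/-- The largest base-`b` digit of `n`. -/
def maxdigit (b n : ℕ) : ℕ := (Nat.digits b n).foldr max 0

/-- Auxiliary function for the level-`m` expansion: `lexpAux m a k = a_{m+1+k}`. -/
def lexpAux (m a : ℕ) : ℕ → ℕ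
  | 0 => a
  | k + 1 => iota (m + 1 + k) (ordb (m + 1 + k) (lexpAux m a k) + 1)

/-- `lexp m a l = a_l`, the `l`-th term of the level-`m` expansion of `a`. -/
def lexp (m a l : ℕ) : ℕ := lexpAux m a (l - (m + 1))

/-- The last element `n` of `π^(m+1)(1, χ^(m+1)(a))`; the level-`m` expansion
of `a` is `a_{m+1}, …, a_n`. -/
def levelEnd (m a : ℕ) : ℕ := (piStr (m + 1) (chi (m + 1) a)).getLastD 0

/-- `V_m := {v ≥ 0 : C(T_{v+1}^(m+1)) ≤ m}`. -/
def Vset (m : ℕ) : Set ℕ := {v | curl (Tstr (m + 1) (v + 1)) ≤ m}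

/-- `Q := {α ≥ 0 : C(T_{α+1}^(2)) = 1}`. -/
def Qset : Set ℕ := {a | curl (Tstr 2 (a + 1)) = 1}

/-- `R := {(a,b) : a ∈ Q, a < b, no suffix S of T_{a+1}^(2) with T_{a+1}^(2)·S = T_{b+1}^(2)}`. -/
def Rset : Set (ℕ × ℕ) :=
  {p | p.1 ∈ Qset ∧ p.1 < p.2 ∧
    ¬∃ S : List ℕ, S <:+ Tstr 2 (p.1 + 1) ∧ Tstr 2 (p.1 + 1) ++ S = Tstr 2 (p.2 + 1)}

/-- The digit of `x` in base `b` at (1-indexed) position `i`, i.e. the coefficient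
of `b^(i-1)`. -/
def digitAt (b x i : ℕ) : ℕ := (Nat.digits b x).getD (i - 1) 0

/-- `u` is the (1-indexed) position of the second nonzero base-`b` digit of `x`
(the first nonzero digit being at position `ord_b(x)+1`). -/
def IsSecondNonzero (b x u : ℕ) : Prop :=
  ordb b x + 1 < u ∧ digitAt b x u ≠ 0 ∧
    ∀ i, ordb b x + 1 < i → i < u → digitAt b x i = 0

/-- `𝒮_b`: pairs `(a,a')` with `1 ≤ a < a'` such that for some position `y` the
base-`b` digits of `a` and `a'` agree away from `y` and twice the `y`-th digit of `a`
is at least the `y`-th digit of `a'`. -/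
def Sset (b : ℕ) : Set (ℕ × ℕ) :=
  {p | 1 ≤ p.1 ∧ p.1 < p.2 ∧
    ∃ y : ℕ, (∀ i, i ≠ y → (Nat.digits b p.1).getD i 0 = (Nat.digits b p.2).getD i 0) ∧
      (Nat.digits b p.2).getD y 0 ≤ 2 * (Nat.digits b p.1).getD y 0}

/-- The glue string `S_t^(m)`, so that `T_{t+1}^(m) = T_t^(m) ++ glue m t`. -/
def glue (m t : ℕ) : List ℕ := (gPrefix (m + 1) (tau m (t + 1))).drop (tau m t)

/-- The strings `P_t^(m)`: `P_1^(m) = (m)` and `P_{t+1}^(m) = P_t^(m)·B_t^(m)·S_t^(m)`. -/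
def Pstr (m : ℕ) : ℕ → List ℕ
  | 0 => []
  | 1 => [m]
  | t + 2 => Pstr m (t + 1) ++ Bstr m (t + 1) ++ glue m (t + 1)

end

/-- The window of length `k * p` ending just before position `l` has period `p`: the prefix of
`a` of length `l` ends in the `k`-th power of a word of length `p`. -/
def EndsInPower (a : ℕ → ℕ) (l k p : ℕ) : Prop :=
  0 < p ∧ k * p ≤ l ∧ ∀ i, l ≤ i + k * p → i + p < l → a i = a (i + p)

theorem getElem?_flatten_replicate (Y : List ℕ) (k i : ℕ) (hi : i < k * Y.length) :
    (List.replicate k Y).flatten[i]? = Y[i % Y.length]? := by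
  induction k generalizing i with
  | zero => simp at hi
  | succ k ih =>
    rw [List.replicate_succ, List.flatten_cons]
    by_cases h : i < Y.length
    · rw [List.getElem?_append_left h, Nat.mod_eq_of_lt h]
    · push Not at h
      rw [List.getElem?_append_right h, ih _ (by rw [Nat.succ_mul] at hi; omega),
        Nat.mod_eq_sub_mod h]

theorem bddAbove_exponents (S : List ℕ) :
    BddAbove {k | ∃ X Y : List ℕ, Y ≠ [] ∧ S = X ++ (List.replicate k Y).flatten} := by
  refine ⟨S.length, ?_⟩
  rintro k ⟨X, Y, hY, rfl⟩
  have := List.length_pos_of_ne_nil hY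
  simp only [List.length_append, List.length_flatten, List.map_replicate, List.sum_replicate,
    smul_eq_mul]
  nlinarith

theorem exists_endsInPower_of_lt_curl {a : ℕ → ℕ} {l c : ℕ} (hc : 1 ≤ c)
    (h : c < curl ((List.range l).map a)) : ∃ p, EndsInPower a l (c + 1) p := by
  set S := (List.range l).map a with hS
  have hlen : S.length = l := by simp [hS]
  have hget : ∀ i, i < l → S[i]? = some (a i) := by
    intro i hi
    simp [hS, hi]
  rw [curl] at h
  have h' := (lt_max_iff.1 h).resolve_left (by omega)
  have hne : {k | ∃ X Y : List ℕ, Y ≠ [] ∧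
      S = X ++ (List.replicate k Y).flatten}.Nonempty :=
    ⟨0, S, [0], by simp, by simp⟩
  obtain ⟨X, Y, hY, hXY⟩ := Nat.sSup_mem hne (bddAbove_exponents S)
  set K := sSup {k | ∃ X Y : List ℕ, Y ≠ [] ∧ S = X ++ (List.replicate k Y).flatten}
  have hp := List.length_pos_of_ne_nil hY
  have hl : X.length + K * Y.length = l := by
    rw [← hlen, hXY]
    simp
  have hle : (c + 1) * Y.length ≤ K * Y.length := Nat.mul_le_mul_right _ h'
  have key : ∀ i, X.length ≤ i → i < l → some (a i) = Y[(i - X.length) % Y.length]? := by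
    intro i hi hil
    rw [← hget i hil, hXY, List.getElem?_append_right hi,
      getElem?_flatten_replicate _ _ _ (by omega)]
  refine ⟨Y.length, hp, by omega, fun i hi hip => ?_⟩
  have h1 := key i (by omega) (by omega)
  have h2 := key (i + Y.length) (by omega) hip
  rw [show i + Y.length - X.length = (i - X.length) + Y.length by omega, Nat.add_mod_right,
    ← h1] at h2
  exact (Option.some.inj h2).symm

theorem EndsInPower.le_curl {a : ℕ → ℕ} {l k p : ℕ} (h : EndsInPower a l k p) :
    k ≤ curl ((List.range l).map a) := by
  obtain ⟨hp, hkl, hper⟩ := h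
  refine le_max_of_le_right (le_csSup (bddAbove_exponents _) ?_)
  rcases Nat.eq_zero_or_pos k with rfl | hk
  · exact ⟨(List.range l).map a, [0], by simp, by simp⟩
  have hpl : p ≤ k * p := Nat.le_mul_of_pos_left p hk
  have iter : ∀ c j, j < p → c < k → a (l - k * p + j + c * p) = a (l - k * p + j) := by
    intro c j hj
    induction c with
    | zero => simp
    | succ c ih =>
      intro hck
      have : (c + 2) * p ≤ k * p := Nat.mul_le_mul_right _ (by omega)
      rw [← ih (by omega), hper (l - k * p + j + c * p) (by omega) (by
        have : (c + 2) * p = c * p + 2 * p := by ring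
        omega)]
      congr 1
      ring
  refine ⟨(List.range (l - k * p)).map a, (List.range p).map fun j => a (l - k * p + j), ?_, ?_⟩
  · simp [hp.ne']
  · apply List.ext_getElem?
    intro i
    by_cases hi : i < l
    · by_cases hi2 : i < l - k * p
      · rw [List.getElem?_append_left (by simpa using hi2)]
        simp [hi, hi2]
      · push Not at hi2
        rw [List.getElem?_append_right (by simpa using hi2),
          getElem?_flatten_replicate _ _ _ (by simp; omega)]
        have hm : (i - (l - k * p)) % p < p := Nat.mod_lt _ hp
        have hd : (i - (l - k * p)) / p < k := by
          rw [Nat.div_lt_iff_lt_mul hp]; omega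
        have hi3 : i = l - k * p + (i - (l - k * p)) % p + (i - (l - k * p)) / p * p := by
          have := Nat.mod_add_div' (i - (l - k * p)) p
          omega
        have := iter _ _ hm hd
        rw [← hi3] at this
        simp [hi, hm, this]
    · push Not at hi
      rw [List.getElem?_eq_none (by simpa using hi), List.getElem?_eq_none]
      simp
      omega

/-- The `i`-th term (0-indexed) of the level-`m` Gijswijt sequence. -/
noncomputable def gseq (m i : ℕ) : ℕ := max m (curl (gPrefix m i))

theorem gPrefix_eq_map_range (m l : ℕ) : gPrefix m l = (List.range l).map (gseq m) := by
  induction l with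
  | zero => simp [gPrefix]
  | succ l ih => rw [List.range_succ, List.map_append, ← ih]; simp [gPrefix, gseq]

/-- The position of the `(x + 1)`-st letter `m` in a word made of blocks, where the `y`-th block
is a letter `m` followed by `τ (multiplicity b y)` other letters. -/
noncomputable def blockStart (b : ℕ) (τ : ℕ → ℕ) (x : ℕ) : ℕ :=
  ∑ y ∈ Finset.range x, (1 + τ (multiplicity b (y + 1)))

/-- Below position `l`, the word `a` is a concatenation of blocks, the `y`-th of which is `m`
followed by the prefix of `a'` of length `τ (multiplicity b y)`. -/
structure IsBlockWord (m b : ℕ) (τ a' a : ℕ → ℕ) (l : ℕ) : Prop where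
  head : ∀ x, blockStart b τ x < l → a (blockStart b τ x) = m
  tail : ∀ x u, u < τ (multiplicity b (x + 1)) → blockStart b τ x + 1 + u < l →
    a (blockStart b τ x + 1 + u) = a' u

theorem blockStart_zero (b : ℕ) (τ : ℕ → ℕ) : blockStart b τ 0 = 0 := rfl

theorem blockStart_succ (b : ℕ) (τ : ℕ → ℕ) (x : ℕ) :
    blockStart b τ (x + 1) = blockStart b τ x + (1 + τ (multiplicity b (x + 1))) :=
  Finset.sum_range_succ _ _

theorem blockStart_strictMono (b : ℕ) (τ : ℕ → ℕ) : StrictMono (blockStart b τ) :=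
  strictMono_nat_of_lt_succ fun x => by rw [blockStart_succ]; omega

theorem exists_block (b : ℕ) (τ : ℕ → ℕ) (i : ℕ) :
    ∃ x, blockStart b τ x ≤ i ∧ i < blockStart b τ (x + 1) := by
  induction i with
  | zero => exact ⟨0, by simp [blockStart_zero], by rw [blockStart_succ]; omega⟩
  | succ i ih =>
    obtain ⟨x, h1, h2⟩ := ih
    by_cases h : i + 1 < blockStart b τ (x + 1)
    · exact ⟨x, by omega, h⟩
    · exact ⟨x + 1, by omega, by rw [blockStart_succ]; omega⟩

theorem pow_dvd_iff_le_mult {b y i : ℕ} (hb : 2 ≤ b) (hy : 0 < y) :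
    b ^ i ∣ y ↔ i ≤ multiplicity b y :=
  (Nat.finiteMultiplicity_iff.2 ⟨by omega, hy⟩).pow_dvd_iff_le_multiplicity

theorem IsBlockWord.eq_iff {m b : ℕ} {τ a' a : ℕ → ℕ} {l : ℕ}
    (h : IsBlockWord m b τ a' a l) (ha' : ∀ u, m < a' u) {i : ℕ} (hi : i < l) :
    a i = m ↔ ∃ x, blockStart b τ x = i := by
  constructor
  · intro him
    obtain ⟨x, h1, h2⟩ := exists_block b τ i
    rcases h1.eq_or_lt with h1 | h1
    · exact ⟨x, h1⟩
    · rw [blockStart_succ] at h2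
      have := h.tail x (i - blockStart b τ x - 1) (by omega) (by omega)
      rw [show blockStart b τ x + 1 + (i - blockStart b τ x - 1) = i by omega, him] at this
      have := ha' (i - blockStart b τ x - 1)
      omega
  · rintro ⟨x, rfl⟩
    exact h.head x hi

theorem IsBlockWord.exists_shift {m b : ℕ} {τ a' a : ℕ → ℕ} {l : ℕ}
    (h : IsBlockWord m b τ a' a l) (ha' : ∀ u, m < a' u) {n K p : ℕ} (hK : 1 ≤ K)
    (hn : blockStart b τ n < l) (hn' : l ≤ blockStart b τ (n + 1))
    (hp : EndsInPower a l (K + 1) p) (hwin : l ≤ blockStart b τ n + p) :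
    ∃ j, 0 < j ∧ (K + 1) * j ≤ n + 1 ∧
      (∀ z, n < z + K * j → z ≤ n → j ≤ z ∧ blockStart b τ z = blockStart b τ (z - j) + p) ∧
      l ≤ blockStart b τ (n + 1 - j) + p := by
  obtain ⟨hp0, hkp, hper⟩ := hp
  have hL : StrictMono (blockStart b τ) := blockStart_strictMono b τ
  set L := blockStart b τ with hLdef
  have hKp : (K + 1) * p = K * p + p := by ring
  have hpK : p ≤ K * p := Nat.le_mul_of_pos_left p hK
  have down : ∀ z ≤ n, l ≤ L z + K * p → ∃ w, L w + p = L z := by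
    intro z hz hlz
    have hzl : L z < l := (hL.monotone hz).trans_lt hn
    have h1 := hper (L z - p) (by omega) (by omega)
    rw [show L z - p + p = L z by omega, h.head z hzl] at h1
    obtain ⟨w, hw⟩ := (h.eq_iff ha' (by omega)).1 h1
    exact ⟨w, by rw [← hLdef] at hw; omega⟩
  have up : ∀ w, l ≤ L w + (K + 1) * p → L w + p < l → ∃ z, L z = L w + p := by
    intro w hw hwl
    have h1 := hper (L w) hw hwl
    rw [h.head w (lt_of_le_of_lt (Nat.le_add_right _ _) hwl)] at h1
    exact (h.eq_iff ha' hwl).1 h1.symm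
  obtain ⟨x, hx⟩ := down n le_rfl (by omega)
  have hxn : x < n := hL.lt_iff_lt.1 (by omega)
  obtain ⟨j, rfl⟩ : ∃ j, n = x + j := ⟨n - x, by omega⟩
  have hj : 0 < j := by omega
  have shift : ∀ i z, z + i = x + j → l ≤ L z + K * p → ∃ w, w + j = z ∧ L w + p = L z := by
    intro i
    induction i with
    | zero =>
      intro z hz _
      obtain rfl : z = x + j := by omega
      exact ⟨x, rfl, hx⟩
    | succ i ih =>
      intro z hz hlz
      have hzz := hL (Nat.lt_succ_self z)
      have hzn := hL.monotone (show z + 1 ≤ x + j by omega)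
      obtain ⟨w, hw, hw'⟩ := ih (z + 1) (by omega) (by simp only [Nat.succ_eq_add_one] at hzz; omega)
      obtain ⟨v, hv⟩ := down z (by omega) hlz
      have hvw : v < w := hL.lt_iff_lt.1 (by simp only [Nat.succ_eq_add_one] at hzz; omega)
      rcases (Nat.succ_le_of_lt hvw).eq_or_lt with hvw | hvw
      · exact ⟨v, by omega, hv⟩
      · exfalso
        have h1 := hL (Nat.lt_succ_self v)
        have h2 := hL hvw
        obtain ⟨y, hy⟩ := up (v + 1) (by simp only [Nat.succ_eq_add_one] at *; omega)
          (by simp only [Nat.succ_eq_add_one] at *; omega)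
        simp only [Nat.succ_eq_add_one] at *
        have h3 : z < y := hL.lt_iff_lt.1 (by omega)
        have h4 : y < z + 1 := hL.lt_iff_lt.1 (by omega)
        omega
  have iter : ∀ i ≤ K, ∃ w, w + i * j = x + j ∧ L w + i * p = L (x + j) := by
    intro i
    induction i with
    | zero => intro _; exact ⟨x + j, by simp, by simp⟩
    | succ i ih =>
      intro hi
      obtain ⟨w, hw, hw'⟩ := ih (by omega)
      have h1 : (i + 1) * p ≤ K * p := Nat.mul_le_mul_right _ hi
      have h2 : (i + 1) * p = i * p + p := by ring
      have h3 : (i + 1) * j = i * j + j := by ring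
      obtain ⟨v, hv, hv'⟩ := shift (i * j) w hw (by omega)
      exact ⟨v, by omega, by omega⟩
  have range : ∀ z, x + j < z + K * j → z ≤ x + j → l ≤ L z + K * p := by
    intro z hz hzn
    by_contra! hlt
    obtain ⟨w, hw, hw'⟩ := iter K le_rfl
    have hwz : L w < L z := hL (by omega)
    have climb : ∀ i ≤ K, ∃ y, L y = L z + i * p := by
      intro i
      induction i with
      | zero => intro _; exact ⟨z, by simp⟩
      | succ i ih =>
        intro hi
        obtain ⟨y, hy⟩ := ih (by omega)
        have h1 : (i + 1) * p ≤ K * p := Nat.mul_le_mul_right _ hi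
        have h2 : (i + 1) * p = i * p + p := by ring
        obtain ⟨y', hy'⟩ := up y (by omega) (by omega)
        exact ⟨y', by omega⟩
    obtain ⟨y, hy⟩ := climb K le_rfl
    have h1 : x + j < y := hL.lt_iff_lt.1 (by omega)
    have h2 := hL.monotone (Nat.succ_le_of_lt h1)
    simp only [Nat.succ_eq_add_one] at *
    omega
  have hKj : (K + 1) * j = K * j + j := by ring
  have hjK : j ≤ K * j := Nat.le_mul_of_pos_left j hK
  have main : ∀ z, x + j < z + K * j → z ≤ x + j → j ≤ z ∧ L z = L (z - j) + p := by
    intro z hz hzn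
    obtain ⟨w, rfl, hw⟩ := shift (x + j - z) z (by omega) (range z hz hzn)
    exact ⟨by omega, by rw [Nat.add_sub_cancel]; exact hw.symm⟩
  refine ⟨j, hj, ?_, main, ?_⟩
  · obtain ⟨w, hw, -⟩ := iter K le_rfl
    by_cases hj1 : j = 1
    · omega
    · have := (main (w + 1) (by omega) (by omega)).1
      omega
  · by_contra! hlt
    have h0 : L x < L (x + j + 1 - j) := hL (by omega)
    obtain ⟨y, hy⟩ := up _ (by omega) hlt
    have h1 : x + j < y := hL.lt_iff_lt.1 (by omega)
    have h2 := hL.monotone (Nat.succ_le_of_lt h1)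
    simp only [Nat.succ_eq_add_one] at *
    omega

theorem multiplicity_dichotomy {b N j K : ℕ} (hb : 2 ≤ b) (hj : 0 < j) (hK : 1 ≤ K)
    (hN : (K + 1) * j ≤ N)
    (hper : ∀ y, N < y + K * j → y < N → j < y ∧ multiplicity b y = multiplicity b (y - j)) :
    ((K + 1) * j ≤ b ^ (multiplicity b j + 1) ∧ multiplicity b (N - j) ≤ multiplicity b j ∧
        (b ^ (multiplicity b j + 1) ∣ N ∨ (K + 1) * j ≤ N % b ^ (multiplicity b j + 1))) ∨
      (K = 1 ∧ multiplicity b j < multiplicity b (N - j) ∧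
        multiplicity b N = multiplicity b j ∧ j < N - j ∧
        multiplicity b (N - j - j) = multiplicity b j) := by
  set e := multiplicity b j with he
  have hKj : (K + 1) * j = K * j + j := by ring
  have hjK : j ≤ K * j := Nat.le_mul_of_pos_left j hK
  have hdj : b ^ e ∣ j := (pow_dvd_iff_le_mult hb hj).2 le_rfl
  have hndj : ¬ b ^ (e + 1) ∣ j := fun h => by
    have := (pow_dvd_iff_le_mult hb hj).1 h
    omega
  have key : ∀ y, N < y + K * j → y < N → ¬ b ^ (e + 1) ∣ y ∧ ¬ b ^ (e + 1) ∣ y - j := by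
    intro y h1 h2
    obtain ⟨h3, h4⟩ := hper y h1 h2
    have h5 : b ^ (e + 1) ∣ y ↔ b ^ (e + 1) ∣ y - j := by
      rw [pow_dvd_iff_le_mult hb (by omega), pow_dvd_iff_le_mult hb (by omega), h4]
    have h6 : ¬ b ^ (e + 1) ∣ y := fun h => hndj <| by
      have := Nat.dvd_sub h (h5.1 h)
      rwa [show y - (y - j) = j by omega] at this
    exact ⟨h6, fun h => h6 (h5.2 h)⟩
  have nodvd : ∀ y, N < y + (K + 1) * j → y < N → (K = 1 → y ≠ N - j) → ¬ b ^ (e + 1) ∣ y := by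
    intro y h1 h2 h3
    by_cases h4 : N < y + K * j
    · exact (key y h4 h2).1
    · have h5 : y + j < N := by
        by_cases hK1 : K = 1
        · have := h3 hK1
          subst hK1
          omega
        · have : 2 * j ≤ K * j := Nat.mul_le_mul_right _ (by omega)
          omega
      have := (key (y + j) (by omega) h5).2
      rwa [Nat.add_sub_cancel] at this
  have hB : 0 < b ^ (e + 1) := by positivity
  by_cases hc : K = 1 ∧ b ^ (e + 1) ∣ N - j
  · right
    refine ⟨hc.1, (pow_dvd_iff_le_mult hb (by omega)).1 hc.2, ?_⟩
    have h1 : b ^ e ∣ N := by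
      have := Nat.dvd_add ((pow_dvd_pow b (Nat.le_succ e)).trans hc.2) hdj
      rwa [Nat.sub_add_cancel (by omega)] at this
    have h2 : ¬ b ^ (e + 1) ∣ N := fun h => hndj <| by
      have := Nat.dvd_sub h hc.2
      rwa [show N - (N - j) = j by omega] at this
    have h3 : N - j ≠ j := fun h => hndj (h ▸ hc.2)
    have hj2 : j < N - j := by
      have := hc.1
      subst this
      omega
    have h4 : b ^ e ∣ N - j - j :=
      Nat.dvd_sub ((pow_dvd_pow b (Nat.le_succ e)).trans hc.2) hdj
    have h5 : ¬ b ^ (e + 1) ∣ N - j - j := fun h => hndj <| by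
      have := Nat.dvd_sub hc.2 h
      rwa [show N - j - (N - j - j) = j by omega] at this
    rw [pow_dvd_iff_le_mult hb (by omega)] at h1 h2 h4 h5
    omega
  · left
    have nodvd' : ∀ y, N < y + (K + 1) * j → y < N → ¬ b ^ (e + 1) ∣ y := by
      intro y h1 h2 h3
      exact nodvd y h1 h2 (fun hK1 hy => hc ⟨hK1, hy ▸ h3⟩) h3
    have hr : multiplicity b (N - j) ≤ e := by
      have := nodvd' (N - j) (by omega) (by omega)
      rw [pow_dvd_iff_le_mult hb (by omega)] at this
      omega
    have hdm := Nat.div_add_mod N (b ^ (e + 1))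
    have hlt := Nat.mod_lt N hB
    by_cases h0 : N % b ^ (e + 1) = 0
    · refine ⟨?_, hr, Or.inl (Nat.dvd_of_mod_eq_zero h0)⟩
      by_contra! hlt2
      exact nodvd' (N - b ^ (e + 1)) (by omega) (by omega)
        (Nat.dvd_sub (Nat.dvd_of_mod_eq_zero h0) dvd_rfl)
    · have h1 := nodvd' (b ^ (e + 1) * (N / b ^ (e + 1)))
      have h2 : ¬ N < b ^ (e + 1) * (N / b ^ (e + 1)) + (K + 1) * j :=
        fun h => h1 h (by have := Nat.pos_of_ne_zero h0; omega) (dvd_mul_right _ _)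
      have h3 : (K + 1) * j ≤ N % b ^ (e + 1) := by
        generalize N % b ^ (e + 1) = r at *
        omega
      exact ⟨by omega, hr, Or.inr h3⟩

theorem IsBlockWord.endsInPower_tail {m b : ℕ} {τ a' a : ℕ → ℕ} {l : ℕ}
    (h : IsBlockWord m b τ a' a l) (ha' : ∀ u, m < a' u) {n k p : ℕ}
    (hn : blockStart b τ n < l) (hn' : l ≤ blockStart b τ (n + 1))
    (hp : EndsInPower a l k p) (hwin : blockStart b τ n + p < l) :
    EndsInPower a' (l - blockStart b τ n - 1) k p := by
  obtain ⟨hp0, hkp, hper⟩ := hp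
  have hL : StrictMono (blockStart b τ) := blockStart_strictMono b τ
  have hout : blockStart b τ n + k * p < l := by
    by_contra! hlt
    have h1 := hper _ hlt hwin
    rw [h.head n hn] at h1
    obtain ⟨y, hy⟩ := (h.eq_iff ha' hwin).1 h1.symm
    have h2 : n < y := hL.lt_iff_lt.1 (by omega)
    have h3 := hL.monotone (Nat.succ_le_of_lt h2)
    simp only [Nat.succ_eq_add_one] at *
    omega
  rw [blockStart_succ] at hn'
  refine ⟨hp0, by omega, fun i hi hip => ?_⟩
  rw [← h.tail n i (by omega) (by omega), ← h.tail n (i + p) (by omega) (by omega),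
    hper _ (by omega) (by omega)]
  congr 1
  omega

theorem multiplicity_eq_of_blockStart_eq {b : ℕ} {τ : ℕ → ℕ}
    (hτ : StrictMono τ) {n K p j : ℕ} (hj : 0 < j) (hjn : (K + 1) * j ≤ n + 1)
    (hmain : ∀ z, n < z + K * j → z ≤ n →
      j ≤ z ∧ blockStart b τ z = blockStart b τ (z - j) + p) :
    ∀ y, n + 1 < y + K * j → y < n + 1 →
      j < y ∧ multiplicity b y = multiplicity b (y - j) := by
  intro y h1 h2
  rcases Nat.eq_zero_or_pos y with rfl | hy
  · have : (K + 1) * j = K * j + j := by ring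
    omega
  obtain ⟨x, rfl⟩ : ∃ x, y = x + 1 := ⟨y - 1, by omega⟩
  obtain ⟨h3, h4⟩ := hmain x (by omega) (by omega)
  obtain ⟨h5, h6⟩ := hmain (x + 1) (by omega) (by omega)
  refine ⟨by omega, ?_⟩
  obtain ⟨w, rfl⟩ : ∃ w, x = w + j := ⟨x - j, by omega⟩
  rw [show w + j + 1 - j = w + 1 by omega] at h6 ⊢
  rw [Nat.add_sub_cancel] at h4
  rw [blockStart_succ, blockStart_succ, h4] at h6
  exact hτ.injective (by omega)

theorem IsBlockWord.exponent_le {m b : ℕ} {τ a' a : ℕ → ℕ} {l : ℕ}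
    (h : IsBlockWord m b τ a' a l) (ha' : ∀ u, m < a' u) (hb : 2 ≤ b) (hτ : StrictMono τ)
    {n K p : ℕ} (hK : 1 ≤ K)
    (hn : blockStart b τ n < l) (hn' : l ≤ blockStart b τ (n + 1))
    (hp : EndsInPower a l (K + 1) p) (hwin : l ≤ blockStart b τ n + p) : K + 1 ≤ b := by
  obtain ⟨j, hj, hjn, hmain, -⟩ := h.exists_shift ha' hK hn hn' hp hwin
  rcases multiplicity_dichotomy hb hj hK hjn (multiplicity_eq_of_blockStart_eq hτ hj hjn hmain) with h1 | h1
  · have h2 := Nat.le_of_dvd hj ((pow_dvd_iff_le_mult hb hj).2 le_rfl)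
    have h3 : (K + 1) * b ^ multiplicity b j ≤ b * b ^ multiplicity b j := by
      rw [← pow_succ']
      exact (Nat.mul_le_mul_left _ h2).trans h1.1
    exact Nat.le_of_mul_le_mul_right h3 (by positivity)
  · omega

theorem IsBlockWord.endsInPower_full {m b : ℕ} {τ a' a : ℕ → ℕ} {n : ℕ}
    (h : IsBlockWord m b τ a' a (blockStart b τ (n + 1))) (ha' : ∀ u, m < a' u) (hb : 2 ≤ b)
    (hτ : StrictMono τ) {K p : ℕ} (hK : 1 ≤ K)
    (hp : EndsInPower a (blockStart b τ (n + 1)) (K + 1) p)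
    (hwin : blockStart b τ (n + 1) ≤ blockStart b τ n + p) :
    (∃ e, (K + 1) * b ^ e ≤ (n + 1) % b ^ (e + 1)) ∨
      (K = 1 ∧ ∃ r v, 0 < v ∧ v ≤ τ (multiplicity b (n + 1)) ∧ EndsInPower a' (τ r) 2 v) := by
  have hL : StrictMono (blockStart b τ) := blockStart_strictMono b τ
  obtain ⟨j, hj, hjn, hmain, hlast⟩ :=
    h.exists_shift ha' hK (hL (Nat.lt_succ_self n)) le_rfl hp hwin
  have hKj : (K + 1) * j = K * j + j := by ring
  have hjK : j ≤ K * j := Nat.le_mul_of_pos_left j hK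
  have hn := hmain n (by omega) le_rfl
  obtain ⟨x, rfl⟩ : ∃ x, n = x + j := ⟨n - j, by omega⟩
  have hz : x + j + 1 - j = x + 1 := by omega
  rw [Nat.add_sub_cancel] at hn
  have hfull := blockStart_succ b τ (x + j)
  have hx := blockStart_succ b τ x
  rw [hz] at hlast
  rcases multiplicity_dichotomy hb hj hK hjn (multiplicity_eq_of_blockStart_eq hτ hj hjn hmain) with h1 | h1
  · left
    rw [hz] at h1
    obtain ⟨-, h2, h3⟩ := h1
    have h4 : τ (multiplicity b (x + j + 1)) ≤ τ (multiplicity b (x + 1)) := by omega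
    have h5 := hτ.le_iff_le.1 h4
    refine ⟨multiplicity b j, (Nat.mul_le_mul_left _
      (Nat.le_of_dvd hj ((pow_dvd_iff_le_mult hb hj).2 le_rfl))).trans (h3.resolve_left ?_)⟩
    rw [pow_dvd_iff_le_mult hb (by omega)]
    omega
  · right
    rw [hz] at h1
    obtain ⟨rfl, h2, h3, h4, h5⟩ := h1
    refine ⟨rfl, multiplicity b (x + 1), ?_⟩
    set r := multiplicity b (x + 1)
    set e := multiplicity b j
    have hprev := hmain (x + 1) (by omega) (by omega)
    obtain ⟨y, rfl⟩ : ∃ y, x = y + j := ⟨x - j, by omega⟩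
    rw [show y + j + 1 - j = y + 1 by omega] at *
    have hyj := hL.monotone (show y ≤ y + j by omega)
    have hy := blockStart_succ b τ y
    rw [h5] at hy
    rw [h3] at hfull ⊢
    have hre := hτ h2
    obtain ⟨hp0, hkp, hper⟩ := hp
    have hve : τ r - τ e ≤ τ e := by
      by_contra! hlt
      have h6 := hper (blockStart b τ y) (by omega) (by omega)
      rw [h.head y (by omega)] at h6
      obtain ⟨w, hw⟩ := (h.eq_iff ha' (by omega)).1 h6.symm
      have h7 : y + j < w := hL.lt_iff_lt.1 (by omega)
      have h8 : w < y + j + 1 := hL.lt_iff_lt.1 (by omega)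
      omega
    refine ⟨τ r - τ e, by omega, hve, by omega, by omega, fun i hi1 hi2 => ?_⟩
    rw [← h.tail y i (by rw [h5]; omega) (by omega),
      ← h.tail (y + j) (i + (τ r - τ e)) (by omega) (by omega), hper _ (by omega) (by omega)]
    congr 1
    omega

theorem IsBlockWord.exists_endsInPower {m b : ℕ} {τ a' a : ℕ → ℕ} {n s : ℕ}
    (hb : 2 ≤ b) (hτ : StrictMono τ) (hs : s < multiplicity b (n + 1))
    (h : IsBlockWord m b τ a' a (blockStart b τ n + 1 + τ s)) :
    ∃ p, EndsInPower a (blockStart b τ n + 1 + τ s) b p := by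
  have hL : StrictMono (blockStart b τ) := blockStart_strictMono b τ
  have hD : b ^ (s + 1) ∣ n + 1 := (pow_dvd_iff_le_mult hb (by omega)).2 hs
  have hDn := Nat.le_of_dvd (by omega) hD
  set q := b ^ s with hq
  have hq0 : 0 < q := by positivity
  rw [pow_succ', ← hq] at hD hDn
  have hbq : 2 * q ≤ b * q := Nat.mul_le_mul_right _ hb
  obtain ⟨n₀, hn₀⟩ : ∃ n₀, n + 1 = n₀ + b * q := ⟨n + 1 - b * q, by omega⟩
  have hle : ∀ y, n₀ < y → y < n + 1 → multiplicity b y ≤ s := by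
    intro y h1 h2
    by_contra! h3
    have h4 : b * q ∣ y := by
      rw [hq, ← pow_succ']
      exact (pow_dvd_iff_le_mult hb (by omega)).2 h3
    have := Nat.le_of_dvd (by omega) (Nat.dvd_sub hD h4)
    omega
  have hmono : ∀ y, n₀ < y → y + q ≤ n + 1 → multiplicity b y ≤ multiplicity b (y + q) := by
    intro y h1 h2
    rw [← pow_dvd_iff_le_mult hb (by omega)]
    exact Nat.dvd_add ((pow_dvd_iff_le_mult hb (by omega)).2 le_rfl)
      (pow_dvd_pow b (hle y h1 (by omega)))
  have heq : ∀ y, n₀ < y → y + q < n + 1 → multiplicity b (y + q) = multiplicity b y := by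
    intro y h1 h2
    refine le_antisymm ?_ (hmono y h1 h2.le)
    rw [← pow_dvd_iff_le_mult hb (by omega)]
    exact (Nat.dvd_add_left (pow_dvd_pow b (hle _ (by omega) h2))).1
      ((pow_dvd_iff_le_mult hb (by omega)).2 le_rfl)
  obtain ⟨x, rfl⟩ : ∃ x, n = x + q := ⟨n - q, by omega⟩
  have hlast : multiplicity b (x + 1) = s := by
    refine le_antisymm (hle _ (by omega) (by omega)) ?_
    rw [← pow_dvd_iff_le_mult hb (by omega)]
    have := Nat.dvd_sub ((Dvd.intro_left b rfl : q ∣ b * q).trans hD) (dvd_refl q)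
    rwa [show x + q + 1 - q = x + 1 by omega] at this
  obtain ⟨p, hp⟩ : ∃ p, blockStart b τ (n₀ + q) = blockStart b τ n₀ + p :=
    ⟨blockStart b τ (n₀ + q) - blockStart b τ n₀, by
      have := hL (show n₀ < n₀ + q by omega)
      omega⟩
  have hp0 : 0 < p := by
    have := hL (show n₀ < n₀ + q by omega)
    omega
  have step : ∀ c, n₀ + c ≤ x →
      blockStart b τ (n₀ + c + q) = blockStart b τ (n₀ + c) + p := by
    intro c
    induction c with
    | zero => intro _; exact hp
    | succ c ih =>
      intro hc
      rw [show n₀ + (c + 1) + q = n₀ + c + q + 1 by ring, blockStart_succ, ih (by omega),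
        ← add_assoc n₀ c 1, blockStart_succ b τ (n₀ + c),
        show n₀ + c + q + 1 = n₀ + c + 1 + q by ring, heq _ (by omega) (by omega)]
      ring
  have mult : ∀ c, c < b → blockStart b τ (n₀ + c * q) = blockStart b τ n₀ + c * p := by
    intro c
    induction c with
    | zero => simp
    | succ c ih =>
      intro hc
      have : (c + 2) * q ≤ b * q := Nat.mul_le_mul_right _ hc
      have h2 : (c + 2) * q = c * q + 2 * q := by ring
      rw [show n₀ + (c + 1) * q = n₀ + c * q + q by ring, step _ (by omega), ih (by omega)]
      ring
  obtain ⟨c, rfl⟩ : ∃ c, b = c + 1 := ⟨b - 1, by omega⟩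
  have hcq : (c + 1) * q = c * q + q := by ring
  have hcp : (c + 1) * p = c * p + p := by ring
  have hx1 := mult c (by omega)
  rw [show n₀ + c * q = x + 1 by omega, blockStart_succ, hlast] at hx1
  obtain ⟨d, rfl⟩ : ∃ d, x = n₀ + d := ⟨x - n₀, by omega⟩
  have hxq := step d le_rfl
  refine ⟨p, hp0, by omega, fun i h1 h2 => ?_⟩
  obtain ⟨y, hy1, hy2⟩ := exists_block (c + 1) τ i
  have h3 : n₀ < y + 1 := hL.lt_iff_lt.1 (by omega)
  have h4 : y < n₀ + d + 1 := by
    refine hL.lt_iff_lt.1 ?_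
    rw [blockStart_succ _ _ (n₀ + d), hlast]
    omega
  obtain ⟨f, rfl⟩ : ∃ f, y = n₀ + f := ⟨y - n₀, by omega⟩
  have h5 := step f (by omega)
  rcases hy1.eq_or_lt with hy1 | hy1
  · rw [← hy1, ← h5, h.head _ (by omega), h.head _ (by omega)]
  · rw [blockStart_succ] at hy2
    have h6 := hτ.monotone (hmono (n₀ + f + 1) (by omega) (by omega))
    have h7 := h.tail (n₀ + f) (i - blockStart (c + 1) τ (n₀ + f) - 1) (by omega) (by omega)
    have h8 := h.tail (n₀ + f + q) (i - blockStart (c + 1) τ (n₀ + f) - 1)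
      (by rw [show n₀ + f + q + 1 = n₀ + f + 1 + q by ring]; omega) (by omega)
    rw [h5] at h8
    rw [show i = blockStart (c + 1) τ (n₀ + f) + 1 +
      (i - blockStart (c + 1) τ (n₀ + f) - 1) by omega, h7, ← h8]
    congr 1
    omega

theorem curl_gPrefix_zero_le (m : ℕ) : curl (gPrefix m 0) ≤ 1 := by
  by_contra! h
  rw [gPrefix_eq_map_range] at h
  obtain ⟨p, hp, h2, -⟩ := exists_endsInPower_of_lt_curl le_rfl h
  omega

theorem gseq_zero {m : ℕ} (hm : 1 ≤ m) : gseq m 0 = m :=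
  max_eq_left ((curl_gPrefix_zero_le m).trans hm)

theorem EndsInPower.le_curl_gPrefix {m l k p : ℕ} (h : EndsInPower (gseq m) l k p) :
    k ≤ curl (gPrefix m l) := by
  rw [gPrefix_eq_map_range]
  exact h.le_curl

theorem exists_endsInPower_gseq {m l c : ℕ} (hc : 1 ≤ c) (h : c < curl (gPrefix m l)) :
    ∃ p, EndsInPower (gseq m) l (c + 1) p := by
  rw [gPrefix_eq_map_range] at h
  exact exists_endsInPower_of_lt_curl hc h

theorem lt_gseq_succ (m u : ℕ) : m < gseq (m + 1) u := lt_max_of_lt_left (Nat.lt_succ_self m)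

/-- The length of the `i`-th (0-indexed) prefix of the level-`(m + 1)` Gijswijt sequence with
curling number at most `m`. -/
noncomputable def tailLen (m i : ℕ) : ℕ := Nat.nth (fun k => curl (gPrefix (m + 1) k) ≤ m) i

theorem tailLen_strictMono (hSH : StandingHyp) {m : ℕ} (hm : 1 ≤ m) : StrictMono (tailLen m) :=
  Nat.nth_strictMono (hSH m hm).2

theorem curl_tailLen_le (hSH : StandingHyp) {m : ℕ} (hm : 1 ≤ m) (i : ℕ) :
    curl (gPrefix (m + 1) (tailLen m i)) ≤ m :=
  Nat.nth_mem_of_infinite (p := fun k => curl (gPrefix (m + 1) k) ≤ m) (hSH m hm).2 i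

theorem exists_tailLen_eq {m u : ℕ} (hu : curl (gPrefix (m + 1) u) ≤ m) :
    ∃ s, tailLen m s = u :=
  ⟨_, Nat.nth_count (p := fun k => curl (gPrefix (m + 1) k) ≤ m) hu⟩

theorem tailLen_zero {m : ℕ} (hm : 1 ≤ m) : tailLen m 0 = 0 :=
  Nat.nth_zero_of_zero ((curl_gPrefix_zero_le _).trans hm)

theorem curl_gPrefix_blockStart_succ_le (hSH : StandingHyp) {m : ℕ} (hm : 1 ≤ m) (n : ℕ)
    (h : IsBlockWord m (m + 1) (tailLen m) (gseq (m + 1)) (gseq m)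
      (blockStart (m + 1) (tailLen m) (n + 1))) :
    curl (gPrefix m (blockStart (m + 1) (tailLen m) (n + 1))) ≤ m := by
  by_contra! hlt
  obtain ⟨p, hp⟩ := exists_endsInPower_gseq hm hlt
  by_cases hwin : blockStart (m + 1) (tailLen m) (n + 1) ≤ blockStart (m + 1) (tailLen m) n + p
  · rcases h.endsInPower_full (lt_gseq_succ m) (by omega) (tailLen_strictMono hSH hm) hm hp hwin
      with ⟨e, he⟩ | ⟨rfl, r, v, -, -, hv⟩
    · have := Nat.mod_lt (n + 1) (show 0 < (m + 1) ^ (e + 1) by positivity)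
      rw [← pow_succ'] at he
      omega
    · have := hv.le_curl_gPrefix.trans (curl_tailLen_le hSH le_rfl r)
      omega
  · have h1 := (h.endsInPower_tail (lt_gseq_succ m)
      (blockStart_strictMono _ _ (Nat.lt_succ_self n)) le_rfl hp (by omega)).le_curl_gPrefix
    rw [blockStart_succ, show ∀ x y : ℕ, x + (1 + y) - x - 1 = y by omega] at h1
    have := h1.trans (curl_tailLen_le hSH hm _)
    omega

theorem gseq_eq_of_isBlockWord (hSH : StandingHyp) {m : ℕ} (hm : 1 ≤ m) (n u : ℕ)
    (h : IsBlockWord m (m + 1) (tailLen m) (gseq (m + 1)) (gseq m)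
      (blockStart (m + 1) (tailLen m) n + 1 + u))
    (hu : u < tailLen m (multiplicity (m + 1) (n + 1))) :
    gseq m (blockStart (m + 1) (tailLen m) n + 1 + u) = gseq (m + 1) u := by
  have hτ := tailLen_strictMono hSH hm
  have hsucc := blockStart_succ (m + 1) (tailLen m) n
  set l := blockStart (m + 1) (tailLen m) n + 1 + u with hl
  have hle : curl (gPrefix m l) ≤ max (m + 1) (curl (gPrefix (m + 1) u)) := by
    by_contra! hlt
    obtain ⟨p, hp⟩ := exists_endsInPower_gseq (by omega) hlt
    by_cases hwin : l ≤ blockStart (m + 1) (tailLen m) n + p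
    · have := h.exponent_le (lt_gseq_succ m) (by omega) hτ (by omega) (by omega) (by omega) hp hwin
      omega
    · have h1 := (h.endsInPower_tail (n := n) (lt_gseq_succ m) (by omega) (by omega) hp
        (by omega)).le_curl_gPrefix
      rw [show l - blockStart (m + 1) (tailLen m) n - 1 = u by omega] at h1
      omega
  by_cases hc : curl (gPrefix (m + 1) u) ≤ m
  · obtain ⟨s, rfl⟩ := exists_tailLen_eq hc
    obtain ⟨p, hp⟩ := h.exists_endsInPower (by omega) hτ (hτ.lt_iff_lt.1 hu)
    have := hp.le_curl_gPrefix
    rw [← hl] at this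
    simp only [gseq]
    omega
  · push Not at hc
    obtain ⟨c, hc'⟩ : ∃ c, curl (gPrefix (m + 1) u) = c + 1 :=
      ⟨curl (gPrefix (m + 1) u) - 1, by omega⟩
    obtain ⟨p, hp0, hkp, hper⟩ := exists_endsInPower_gseq (show 1 ≤ c by omega)
      (show c < curl (gPrefix (m + 1) u) by omega)
    have : EndsInPower (gseq m) l (c + 1) p := by
      refine ⟨hp0, by omega, fun i h1 h2 => ?_⟩
      obtain ⟨j, rfl⟩ : ∃ j, i = blockStart (m + 1) (tailLen m) n + 1 + j :=
        ⟨i - blockStart (m + 1) (tailLen m) n - 1, by omega⟩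
      rw [add_assoc _ j p, h.tail n j (by omega) (by omega),
        h.tail n (j + p) (by omega) (by omega), hper j (by omega) (by omega)]
    have := this.le_curl_gPrefix
    simp only [gseq]
    omega

theorem isBlockWord_gseq (hSH : StandingHyp) {m : ℕ} (hm : 1 ≤ m) (l : ℕ) :
    IsBlockWord m (m + 1) (tailLen m) (gseq (m + 1)) (gseq m) l := by
  induction l with
  | zero => exact ⟨fun x h => by omega, fun x u _ h => by omega⟩
  | succ l ih =>
    constructor
    · intro x hx
      rcases (Nat.lt_succ_iff.1 hx).lt_or_eq with h | h
      · exact ih.head x h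
      · rcases x with _ | x
        · rw [blockStart_zero, gseq_zero hm]
        · rw [← h] at ih
          exact max_eq_left (curl_gPrefix_blockStart_succ_le hSH hm x ih)
    · intro x u hu hx
      rcases (Nat.lt_succ_iff.1 hx).lt_or_eq with h | h
      · exact ih.tail x u hu h
      · rw [← h] at ih
        exact gseq_eq_of_isBlockWord hSH hm x u ih hu

theorem curl_gPrefix_blockStart_le_of_mod_lt (hSH : StandingHyp) {m : ℕ} (hm : 1 ≤ m) {n : ℕ}
    (hdvd : ¬ (m + 2) ∣ n + 1)
    (hmod : ∀ e, (n + 1) % (m + 2) ^ (e + 1) < (m + 1) * (m + 2) ^ e) :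
    curl (gPrefix (m + 1) (blockStart (m + 2) (tailLen (m + 1)) (n + 1))) ≤ m := by
  by_contra! hlt
  have h := isBlockWord_gseq hSH (show 1 ≤ m + 1 by omega)
    (blockStart (m + 2) (tailLen (m + 1)) (n + 1))
  have hmul : multiplicity (m + 2) (n + 1) = 0 := multiplicity_eq_zero.2 hdvd
  have h0 := tailLen_zero (show 1 ≤ m + 1 by omega)
  obtain ⟨p, hp⟩ := exists_endsInPower_gseq hm hlt
  by_cases hwin : blockStart (m + 2) (tailLen (m + 1)) (n + 1) ≤
      blockStart (m + 2) (tailLen (m + 1)) n + p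
  · rcases h.endsInPower_full (lt_gseq_succ _) (by omega) (tailLen_strictMono hSH (by omega)) hm
      hp hwin with ⟨e, he⟩ | ⟨-, r, v, hv, hv', -⟩
    · exact absurd (hmod e) (not_lt.2 he)
    · rw [hmul, h0] at hv'
      omega
  · have := blockStart_succ (m + 2) (tailLen (m + 1)) n
    rw [hmul, h0] at this
    have := hp.1
    omega

/-- Read the binary digits of `a` in base `b`. -/
def spread (b a : ℕ) : ℕ := if a = 0 then 0 else b * spread b (a / 2) + a % 2

theorem spread_eq (b a : ℕ) : spread b a = b * spread b (a / 2) + a % 2 := by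
  by_cases h : a = 0
  · subst h
    simp [spread]
  · rw [spread, if_neg h]

theorem spread_zero (b : ℕ) : spread b 0 = 0 := by simp [spread]

theorem spread_strictMono {b : ℕ} (hb : 2 ≤ b) : StrictMono (spread b) := by
  intro a a' h
  induction a' using Nat.strong_induction_on generalizing a with
  | _ a' ih =>
    rw [spread_eq b a, spread_eq b a']
    rcases (Nat.div_le_div_right (c := 2) h.le).lt_or_eq with h1 | h1
    · have := ih (a' / 2) (by omega) h1
      have h2 : b * (spread b (a / 2) + 1) ≤ b * spread b (a' / 2) := Nat.mul_le_mul_left _ this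
      rw [mul_add] at h2
      omega
    · rw [h1]
      omega

theorem spread_lt_pow {b : ℕ} (hb : 2 ≤ b) (i : ℕ) : ∀ a, a < 2 ^ i → spread b a < b ^ i := by
  induction i with
  | zero =>
    intro a h
    obtain rfl : a = 0 := by simpa using h
    simp [spread_zero]
  | succ i ih =>
    intro a h
    have h1 := ih (a / 2) (by rw [pow_succ] at h; omega)
    have h2 : b * (spread b (a / 2) + 1) ≤ b * b ^ i := Nat.mul_le_mul_left _ h1
    rw [spread_eq, pow_succ']
    rw [mul_add] at h2
    omega

theorem spread_mod_lt (c e : ℕ) (hc : 1 ≤ c) :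
    ∀ a, c * (spread (c + 1) a % (c + 1) ^ e) < (c + 1) ^ e := by
  induction e with
  | zero => intro a; simp [Nat.mod_one]
  | succ e ih =>
    intro a
    have h1 := ih (a / 2)
    have h2 : a % 2 ≤ 1 := by omega
    rw [pow_succ', Nat.mod_mul, spread_eq, Nat.mul_add_mod, Nat.mod_eq_of_lt (by omega),
      Nat.mul_add_div (by omega), Nat.div_eq_of_lt (show a % 2 < c + 1 by omega), add_zero]
    set t := spread (c + 1) (a / 2) % (c + 1) ^ e
    have h3 : (c + 1) * (c * t + 1) ≤ (c + 1) * (c + 1) ^ e := Nat.mul_le_mul_left _ h1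
    have h4 : c * (a % 2) ≤ c * 1 := Nat.mul_le_mul_left _ h2
    nlinarith

theorem tailLen_le_blockStart (hSH : StandingHyp) {m : ℕ} (hm : 1 ≤ m) (i : ℕ) :
    tailLen m i ≤ blockStart (m + 2) (tailLen (m + 1)) (spread (m + 2) (2 * i - 1)) := by
  set g : ℕ → ℕ := fun i =>
    blockStart (m + 2) (tailLen (m + 1)) (spread (m + 2) (2 * i - 1)) with hg
  have hmono : StrictMono g := (blockStart_strictMono _ _).comp
    ((spread_strictMono (by omega)).comp fun i j (h : i < j) =>
      show 2 * i - 1 < 2 * j - 1 by omega)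
  have hmem : ∀ i, curl (gPrefix (m + 1) (g i)) ≤ m := by
    intro i
    rcases i with _ | i
    · simp only [hg, Nat.mul_zero, Nat.zero_sub, spread_zero, blockStart_zero]
      exact (curl_gPrefix_zero_le _).trans hm
    · have h1 : spread (m + 2) (2 * (i + 1) - 1) = (m + 2) * spread (m + 2) i + 1 := by
        rw [spread_eq, show 2 * (i + 1) - 1 = 2 * i + 1 by omega]
        congr 2
        · congr 1; omega
        · omega
      have h2 := fun e => spread_mod_lt (m + 1) (e + 1) (by omega) (2 * (i + 1) - 1)
      simp only [hg]
      rw [show m + 1 + 1 = m + 2 by ring] at h2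
      rw [h1] at h2 ⊢
      refine curl_gPrefix_blockStart_le_of_mod_lt hSH hm ?_ fun e => ?_
      · rw [Nat.dvd_add_right (dvd_mul_right _ _), Nat.dvd_one]
        omega
      · by_contra! h3
        have h4 := (Nat.mul_le_mul_left (m + 1) h3).trans_lt (h2 e)
        rw [pow_succ', ← mul_assoc] at h4
        have h5 := lt_of_mul_lt_mul_right h4 (Nat.zero_le _)
        nlinarith
  suffices ∀ i, ∃ j, i ≤ j ∧ tailLen m j = g i by
    obtain ⟨j, hij, hj⟩ := this i
    exact ((tailLen_strictMono hSH hm).monotone hij).trans hj.le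
  intro i
  induction i with
  | zero =>
    obtain ⟨j, hj⟩ := exists_tailLen_eq (hmem 0)
    exact ⟨j, Nat.zero_le _, hj⟩
  | succ i ih =>
    obtain ⟨j, hij, hj⟩ := ih
    obtain ⟨j', hj'⟩ := exists_tailLen_eq (hmem (i + 1))
    have : j < j' := (tailLen_strictMono hSH hm).lt_iff_lt.1 (by
      rw [hj, hj']; exact hmono (Nat.lt_succ_self i))
    exact ⟨j', by omega, hj'⟩

theorem blockStart_lt {b : ℕ} {τ : ℕ → ℕ} (hb : 2 ≤ b) (hτ : Monotone τ) {n d : ℕ}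
    (hn : n < b ^ (d + 1)) : 1 + blockStart b τ n ≤ b ^ (d + 1) * (1 + τ d) := by
  have h1 : blockStart b τ n ≤ n * (1 + τ d) := by
    rw [blockStart]
    refine (Finset.sum_le_card_nsmul _ _ (1 + τ d) fun y hy => ?_).trans (by simp)
    rw [Finset.mem_range] at hy
    refine Nat.add_le_add_left (hτ ?_) 1
    by_contra! h
    have := Nat.le_of_dvd (by omega) ((pow_dvd_iff_le_mult hb (by omega)).2 h)
    simp only [Nat.succ_eq_add_one] at this
    omega
  have h2 : (n + 1) * (1 + τ d) ≤ b ^ (d + 1) * (1 + τ d) := Nat.mul_le_mul_right _ hn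
  rw [add_mul] at h2
  omega

theorem tailLen_succ_le (hSH : StandingHyp) {m : ℕ} (hm : 1 ≤ m) (i : ℕ) :
    1 + tailLen m (i + 1) ≤ (m + 2) ^ (i.size + 1) * (1 + tailLen (m + 1) i.size) := by
  refine (Nat.add_le_add_left (tailLen_le_blockStart hSH hm (i + 1)) 1).trans
    (blockStart_lt (by omega) (tailLen_strictMono hSH (by omega)).monotone
      (spread_lt_pow (by omega) _ _ ?_))
  have := Nat.lt_size_self i
  rw [pow_succ]
  omega

theorem four_mul_size_le (i : ℕ) : 4 * i.size ≤ 3 * i + 2 := by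
  suffices h : ∀ i, i < 2 ^ ((3 * i + 2) / 4) by
    have := Nat.size_le.2 (h i)
    omega
  intro i
  induction i using Nat.strong_induction_on with
  | _ i ih =>
    by_cases hi : i < 4
    · interval_cases i <;> norm_num
    · obtain ⟨j, rfl⟩ : ∃ j, i = j + 4 := ⟨i - 4, by omega⟩
      have := ih j (by omega)
      rw [show (3 * (j + 4) + 2) / 4 = (3 * j + 2) / 4 + 3 by omega, pow_add]
      omega

theorem tailLen_le_pow (hSH : StandingHyp) (i : ℕ) :
    ∀ m, 1 ≤ m → 1 + tailLen m i ≤ (m + 1 + i) ^ (3 * i) := by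
  induction i using Nat.strong_induction_on with
  | _ i ih =>
    intro m hm
    rcases i with _ | i
    · simp [tailLen_zero hm]
    · have h4 := four_mul_size_le i
      calc 1 + tailLen m (i + 1)
          ≤ (m + 2) ^ (i.size + 1) * (1 + tailLen (m + 1) i.size) := tailLen_succ_le hSH hm i
        _ ≤ (m + 1 + (i + 1)) ^ (i.size + 1) * (m + 1 + (i + 1)) ^ (3 * i.size) := by
            refine Nat.mul_le_mul (Nat.pow_le_pow_left (by omega) _)
              ((ih i.size (by omega) (m + 1) (by omega)).trans
                (Nat.pow_le_pow_left (by omega) _))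
        _ ≤ (m + 1 + (i + 1)) ^ (3 * (i + 1)) := by
            rw [← pow_add]
            exact Nat.pow_le_pow_right (by omega) (by omega)

theorem tailLen_succ_le_pow (hSH : StandingHyp) {m : ℕ} (hm : 1 ≤ m) (i : ℕ) :
    1 + tailLen m (i + 1) ≤ 2 ^ ((m + 2 + i.size) * (4 * i.size + 1)) := by
  calc 1 + tailLen m (i + 1)
      ≤ (m + 2) ^ (i.size + 1) * (1 + tailLen (m + 1) i.size) := tailLen_succ_le hSH hm i
    _ ≤ (m + 2 + i.size) ^ (i.size + 1) * (m + 2 + i.size) ^ (3 * i.size) := by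
        refine Nat.mul_le_mul (Nat.pow_le_pow_left (by omega) _)
          ((tailLen_le_pow hSH i.size (m + 1) (by omega)).trans
            (Nat.pow_le_pow_left (by omega) _))
    _ = (m + 2 + i.size) ^ (4 * i.size + 1) := by
        rw [← pow_add]
        congr 1
        ring
    _ ≤ 2 ^ ((m + 2 + i.size) * (4 * i.size + 1)) := by
        rw [pow_mul]
        exact Nat.pow_le_pow_left Nat.lt_two_pow_self.le _


theorem card_multiplicity_eq_add_div {b : ℕ} (hb : 2 ≤ b) (i x : ℕ) :
    ((Finset.range x).filter fun y => multiplicity b (y + 1) = i).card + x / b ^ (i + 1) =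
      x / b ^ i := by
  rw [← Nat.card_multiples x (b ^ i), ← Nat.card_multiples x (b ^ (i + 1)),
    ← Finset.card_union_of_disjoint]
  · congr 1
    ext y
    simp only [Finset.mem_union, Finset.mem_filter, pow_dvd_iff_le_mult hb (show 0 < y + 1 by omega),
      ← and_or_left]
    refine and_congr_right fun _ => ?_
    omega
  · rw [Finset.disjoint_filter]
    intro y _ h h'
    rw [pow_dvd_iff_le_mult hb (show 0 < y + 1 by omega)] at h'
    omega

theorem tendsto_natDiv_div_atTop (k : ℕ) :
    Tendsto (fun x : ℕ => ((x / k : ℕ) : ℝ) / x) atTop (nhds (1 / k)) := by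
  have h := (tendsto_nat_floor_mul_div_atTop (R := ℝ) (a := 1 / k) (by positivity)).comp
    tendsto_natCast_atTop_atTop
  refine h.congr fun x => ?_
  simp only [Function.comp]
  rw [one_div_mul_eq_div, Nat.floor_div_eq_div]

/-- If `∑ g i / b ^ i` converges, then `g` has a mean value along the `b`-adic multiplicities of
`1, 2, 3, …`. -/
theorem exists_tendsto_mean_multiplicity {b : ℕ} (hb : 2 ≤ b) {g : ℕ → ℕ}
    (hg : Summable fun i => (g i : ℝ) / b ^ i) (hpos : ∃ i, 0 < g i) :
    ∃ G : ℝ, 0 < G ∧ Tendsto (fun x : ℕ =>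
      ((∑ y ∈ Finset.range x, g (multiplicity b (y + 1)) : ℕ) : ℝ) / x) atTop (nhds G) := by
  set N : ℕ → ℕ → ℕ := fun x i =>
    ((Finset.range x).filter fun y => multiplicity b (y + 1) = i).card with hN
  have hb1 : (1 : ℝ) < b := by exact_mod_cast (show 1 < b by omega)
  have hlt : ∀ i, (1 : ℝ) / b ^ (i + 1) < 1 / b ^ i := fun i =>
    one_div_lt_one_div_of_lt (by positivity) (pow_lt_pow_right₀ hb1 (Nat.lt_succ_self i))
  have hle : ∀ x i, (N x i : ℝ) / x ≤ 1 / b ^ i := by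
    intro x i
    rcases Nat.eq_zero_or_pos x with rfl | hx
    · simp
    · rw [div_le_iff₀ (by exact_mod_cast hx), one_div_mul_eq_div]
      have h1 : N x i ≤ x / b ^ i :=
        (Nat.le_add_right _ _).trans_eq (card_multiplicity_eq_add_div hb i x)
      calc (N x i : ℝ) ≤ (x / b ^ i : ℕ) := by exact_mod_cast h1
        _ ≤ (x : ℝ) / (b ^ i : ℕ) := Nat.cast_div_le
        _ = x / b ^ i := by push_cast; rfl
  have hlim : ∀ i, Tendsto (fun x => (N x i : ℝ) / x) atTop
      (nhds (1 / b ^ i - 1 / b ^ (i + 1))) := by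
    intro i
    have h := (tendsto_natDiv_div_atTop (b ^ i)).sub (tendsto_natDiv_div_atTop (b ^ (i + 1)))
    push_cast at h
    refine h.congr fun x => ?_
    have h2 : ((N x i : ℕ) : ℝ) + (x / b ^ (i + 1) : ℕ) = (x / b ^ i : ℕ) := by
      exact_mod_cast card_multiplicity_eq_add_div hb i x
    rw [← h2]
    ring
  have hsum : ∀ x : ℕ, ((∑ y ∈ Finset.range x, g (multiplicity b (y + 1)) : ℕ) : ℝ) / x =
      ∑' i, (g i : ℝ) * ((N x i : ℝ) / x) := by
    intro x
    rw [tsum_eq_sum (s := (Finset.range x).image fun y => multiplicity b (y + 1)),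
      Finset.sum_comp g fun y => multiplicity b (y + 1)]
    · push_cast
      rw [Finset.sum_div]
      refine Finset.sum_congr rfl fun i _ => ?_
      simp only [hN, smul_eq_mul]
      push_cast
      ring
    · intro i hi
      have : N x i = 0 := by
        rw [Finset.card_eq_zero, Finset.filter_eq_empty_iff]
        intro y hy h
        exact hi (Finset.mem_image.2 ⟨y, hy, h⟩)
      simp [this]
  refine ⟨∑' i, (g i : ℝ) * (1 / b ^ i - 1 / b ^ (i + 1)), ?_, ?_⟩
  · obtain ⟨i, hi⟩ := hpos
    refine Summable.tsum_pos ?_ (fun j => ?_) i ?_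
    · refine hg.of_nonneg_of_le (fun j => ?_) fun j => ?_
      · exact mul_nonneg (Nat.cast_nonneg _) (sub_nonneg.2 (hlt j).le)
      · rw [div_eq_mul_one_div (g j : ℝ)]
        exact mul_le_mul_of_nonneg_left (sub_le_self _ (by positivity)) (Nat.cast_nonneg _)
    · exact mul_nonneg (Nat.cast_nonneg _) (sub_nonneg.2 (hlt j).le)
    · exact mul_pos (by exact_mod_cast hi) (sub_pos.2 (hlt i))
  · simp only [hsum]
    refine tendsto_tsum_of_dominated_convergence hg (fun i => (hlim i).const_mul _)
      (Eventually.of_forall fun x i => ?_)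
    rw [Real.norm_of_nonneg (by positivity), div_eq_mul_one_div (g i : ℝ)]
    exact mul_le_mul_of_nonneg_left (hle x i) (Nat.cast_nonneg _)

theorem summable_tailLen_div_pow (hSH : StandingHyp) {m : ℕ} (hm : 1 ≤ m) :
    Summable fun i => ((1 + tailLen m i : ℕ) : ℝ) / (m + 1 : ℕ) ^ i := by
  have hsize : Tendsto Nat.size atTop atTop := by
    refine tendsto_atTop_atTop.2 fun s => ⟨2 ^ s, fun i hi => ?_⟩
    exact (Nat.lt_size.2 hi).le
  have hev : ∀ᶠ s : ℕ in atTop, 4 * ((m + 2 + s) * (4 * s + 1)) ≤ 2 ^ s := by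
    have h1 := (tendsto_pow_const_div_const_pow_of_one_lt 2 (one_lt_two (α := ℝ))).eventually
      (gt_mem_nhds (show (0 : ℝ) < 1 / (20 * (m + 3)) by positivity))
    filter_upwards [h1, eventually_ge_atTop 1] with s hs hs1
    rw [div_lt_div_iff₀ (by positivity) (by positivity)] at hs
    have hs' : s ^ 2 * (20 * (m + 3)) < 1 * 2 ^ s := by exact_mod_cast hs
    have h2 : 4 * s + 1 ≤ 5 * s := by omega
    have h3 : m + 2 + s ≤ (m + 3) * s := by nlinarith
    have := Nat.mul_le_mul h3 h2
    nlinarith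
  have hbound : ∀ᶠ i : ℕ in atTop,
      ‖((1 + tailLen m (i + 1) : ℕ) : ℝ) / (m + 1 : ℕ) ^ (i + 1)‖ ≤ (3 / 4 : ℝ) ^ i := by
    filter_upwards [hsize.eventually hev, eventually_ge_atTop 1] with i hi hi1
    have h1 : 2 ^ (i.size - 1) ≤ i := Nat.lt_size.1 (by have := Nat.size_pos.2 hi1; omega)
    have h2 : 2 ^ i.size ≤ 2 * i := by
      obtain ⟨s, hs⟩ : ∃ s, i.size = s + 1 :=
        ⟨i.size - 1, by have := Nat.size_pos.2 hi1; omega⟩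
      rw [hs] at h1 ⊢
      rw [pow_succ']
      exact Nat.mul_le_mul_left 2 h1
    have h3 : ((1 + tailLen m (i + 1) : ℕ) : ℝ) ≤ (3 / 2) ^ i := by
      refine (pow_le_pow_iff_left₀ (by positivity) (by positivity) two_ne_zero).1 ?_
      calc ((1 + tailLen m (i + 1) : ℕ) : ℝ) ^ 2
          ≤ ((2 ^ ((m + 2 + i.size) * (4 * i.size + 1)) : ℕ) : ℝ) ^ 2 := by
            gcongr
            exact tailLen_succ_le_pow hSH hm i
        _ = 2 ^ ((m + 2 + i.size) * (4 * i.size + 1) * 2) := by push_cast; rw [pow_mul _ _ 2]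
        _ ≤ 2 ^ i := pow_le_pow_right₀ one_le_two (by omega)
        _ ≤ ((3 / 2) ^ 2) ^ i := by gcongr; norm_num
        _ = ((3 / 2) ^ i) ^ 2 := by rw [← pow_mul, ← pow_mul, mul_comm]
    rw [Real.norm_of_nonneg (by positivity)]
    calc ((1 + tailLen m (i + 1) : ℕ) : ℝ) / (m + 1 : ℕ) ^ (i + 1)
        ≤ (3 / 2) ^ i / 2 ^ i := by
          gcongr
          calc (2 : ℝ) ^ i ≤ 2 ^ (i + 1) := pow_le_pow_right₀ one_le_two (Nat.le_succ i)
            _ ≤ _ := by gcongr; exact_mod_cast (show 2 ≤ m + 1 by omega)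
      _ = (3 / 4) ^ i := by rw [← div_pow]; norm_num
  exact (summable_nat_add_iff 1).1 (Summable.of_norm_bounded_eventually_nat
    (summable_geometric_of_lt_one (by norm_num) (by norm_num)) hbound)

/-- The number of occurrences of `n` in one block of the level-`m` Gijswijt sequence indexed by a
number of multiplicity `i`. -/
noncomputable def blockCount (m n i : ℕ) : ℕ :=
  (if m = n then 1 else 0) + Nat.count (fun u => gseq (m + 1) u = n) (tailLen m i)

theorem count_gseq_blockStart (hSH : StandingHyp) {m : ℕ} (hm : 1 ≤ m) (n x : ℕ) :
    Nat.count (fun i => gseq m i = n) (blockStart (m + 1) (tailLen m) x) =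
      ∑ y ∈ Finset.range x, blockCount m n (multiplicity (m + 1) (y + 1)) := by
  induction x with
  | zero => simp [blockStart_zero]
  | succ x ih =>
    have h := isBlockWord_gseq hSH hm (blockStart (m + 1) (tailLen m) (x + 1))
    have hlt := blockStart_strictMono (m + 1) (tailLen m) (Nat.lt_succ_self x)
    have hsucc := blockStart_succ (m + 1) (tailLen m) x
    rw [Finset.sum_range_succ, ← ih, hsucc, Nat.count_add, Nat.count_add _ 1, Nat.count_one,
      add_zero, h.head x hlt, blockCount]
    congr 2
    rw [Nat.count_eq_card_filter_range, Nat.count_eq_card_filter_range]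
    congr 1
    refine Finset.filter_congr fun u hu => ?_
    rw [Finset.mem_range] at hu
    rw [← add_assoc, h.tail x u hu (by omega)]

theorem exists_blockCount_pos (hSH : StandingHyp) {m n : ℕ} (hm : 1 ≤ m) (hn : m ≤ n) :
    ∃ i, 0 < blockCount m n i := by
  suffices h : ∀ d m, 1 ≤ m → ∃ u, gseq m u = m + d by
    rcases hn.eq_or_lt with rfl | hlt
    · exact ⟨0, by simp [blockCount]⟩
    · obtain ⟨u, hu⟩ := h (n - (m + 1)) (m + 1) (by omega)
      have hu' : gseq (m + 1) u = n := by omega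
      refine ⟨u + 1, Nat.add_pos_right _ ?_⟩
      have : u < tailLen m (u + 1) := (tailLen_strictMono hSH hm).le_apply
      exact Nat.pos_of_ne_zero fun h0 => Nat.count_iff_forall_not.1 h0 u this hu'
  intro d
  induction d with
  | zero => exact fun m hm => ⟨0, gseq_zero hm⟩
  | succ d ih =>
    intro m hm
    obtain ⟨u, hu⟩ := ih (m + 1) (by omega)
    have hlt : u < tailLen m (u + 1) := (tailLen_strictMono hSH hm).le_apply
    have hpow : 0 < (m + 1) ^ (u + 1) := by positivity
    obtain ⟨x, hx⟩ : ∃ x, x + 1 = (m + 1) ^ (u + 1) := ⟨(m + 1) ^ (u + 1) - 1, by omega⟩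
    refine ⟨blockStart (m + 1) (tailLen m) x + 1 + u, ?_⟩
    rw [(isBlockWord_gseq hSH hm _).tail x u ?_ (Nat.lt_succ_self _), hu]
    · omega
    · refine hlt.trans_le ((tailLen_strictMono hSH hm).monotone ?_)
      rw [← pow_dvd_iff_le_mult (by omega) (Nat.succ_pos x), Nat.succ_eq_add_one, hx]

theorem tendsto_count_div_of_blocks {p : ℕ → Prop} [DecidablePred p] {L : ℕ → ℕ}
    (hL : StrictMono L) (hblock : ∀ N, ∃ x, L x ≤ N ∧ N < L (x + 1)) {G H : ℝ} (hH : 0 < H)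
    (hG : Tendsto (fun x : ℕ => (Nat.count p (L x) : ℝ) / x) atTop (nhds G))
    (hLH : Tendsto (fun x : ℕ => (L x : ℝ) / x) atTop (nhds H)) :
    Tendsto (fun N : ℕ => (Nat.count p N : ℝ) / N) atTop (nhds (G / H)) := by
  choose X hX using hblock
  have hXtop : Tendsto X atTop atTop := by
    refine tendsto_atTop_atTop.2 fun B => ⟨L B, fun N hN => ?_⟩
    have := hL.lt_iff_lt.1 (hN.trans_lt (hX N).2)
    omega
  have hratio : Tendsto (fun x : ℕ => (x : ℝ) / (x + 1 : ℕ)) atTop (nhds 1) := by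
    simpa using tendsto_natCast_div_add_atTop (1 : ℝ)
  have hone : Tendsto (fun x : ℕ => x + 1) atTop atTop := tendsto_add_atTop_nat 1
  have hlow : Tendsto (fun x : ℕ => (Nat.count p (L x) : ℝ) / L (x + 1)) atTop
      (nhds (G / H)) := by
    have h := (hG.mul hratio).div (hLH.comp hone) hH.ne'
    rw [mul_one] at h
    refine h.congr' ?_
    filter_upwards [eventually_ge_atTop 1] with x hx
    have h1 : (x : ℝ) ≠ 0 := by positivity
    have h2 : ((x + 1 : ℕ) : ℝ) ≠ 0 := by positivity
    simp only [Function.comp, Pi.div_apply]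
    field_simp
  have hup : Tendsto (fun x : ℕ => (Nat.count p (L (x + 1)) : ℝ) / L x) atTop
      (nhds (G / H)) := by
    have h := ((hG.comp hone).div hratio one_ne_zero).div hLH hH.ne'
    rw [div_one] at h
    refine h.congr' ?_
    filter_upwards [eventually_ge_atTop 1] with x hx
    have h1 : (x : ℝ) ≠ 0 := by positivity
    have h2 : ((x + 1 : ℕ) : ℝ) ≠ 0 := by positivity
    simp only [Function.comp, Pi.div_apply]
    field_simp
  refine tendsto_of_tendsto_of_tendsto_of_le_of_le' (hlow.comp hXtop) (hup.comp hXtop) ?_ ?_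
  · filter_upwards [eventually_ge_atTop 1] with N hN
    have h0 : (0 : ℝ) < N := by exact_mod_cast hN
    simp only [Function.comp]
    gcongr
    · exact (hX N).1
    · exact (hX N).2.le
  · filter_upwards [hXtop.eventually (eventually_ge_atTop 1)] with N hN
    have h0 : (0 : ℝ) < L (X N) := by
      exact_mod_cast (show 0 < X N from hN).trans_le hL.le_apply
    simp only [Function.comp]
    gcongr
    · exact (hX N).2.le
    · exact (hX N).1

/-- Theorem `asymptotic density`. For `m ≥ 1` and `n ≥ m`, the set
`{p ≥ 1 : A^(m)(p) = n}` has a positive asymptotic density `δ`. -/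
theorem statement17 (hSH : StandingHyp) (m n : ℕ) (hm : 1 ≤ m) (hn : m ≤ n) :
    ∃ δ : ℝ, 0 < δ ∧
      Tendsto (fun N : ℕ =>
          (((Finset.Icc 1 N).filter (fun p => gij m p = n)).card : ℝ) / (N : ℝ))
        atTop (nhds δ) := by
  have hsum := summable_tailLen_div_pow hSH hm
  have hle : ∀ i, blockCount m n i ≤ 1 + tailLen m i := fun i =>
    Nat.add_le_add (by split_ifs <;> omega) (Nat.count_le _)
  have hsum' : Summable fun i => (blockCount m n i : ℝ) / (m + 1 : ℕ) ^ i := by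
    refine hsum.of_nonneg_of_le (fun i => by positivity) fun i => ?_
    gcongr
    exact hle i
  obtain ⟨G, hG, hGlim⟩ := exists_tendsto_mean_multiplicity (by omega) hsum'
    (exists_blockCount_pos hSH hm hn)
  obtain ⟨H, hH, hHlim⟩ := exists_tendsto_mean_multiplicity (by omega) hsum ⟨0, by omega⟩
  refine ⟨G / H, div_pos hG hH, ?_⟩
  have h := tendsto_count_div_of_blocks (p := fun i => gseq m i = n)
    (blockStart_strictMono (m + 1) (tailLen m)) (exists_block _ _) hH
    (by simpa only [count_gseq_blockStart hSH hm] using hGlim) hHlim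
  refine h.congr fun N => ?_
  rw [Nat.count_eq_card_filter_range]
  congr 2
  refine Finset.card_bij (fun i _ => i + 1) (fun i hi => ?_) (fun i _ j _ hij => by omega)
    fun p hp => ?_
  · simp only [Finset.mem_filter, Finset.mem_range, Finset.mem_Icc] at hi ⊢
    exact ⟨by omega, hi.2⟩
  · simp only [Finset.mem_filter, Finset.mem_range, Finset.mem_Icc] at hp ⊢
    exact ⟨p - 1, ⟨by omega, hp.2⟩, by omega⟩
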